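/- arXiv:1801.09565 — 2 statements merged into one kernel-verified Lean document; each statement's English description precedes it below -/
import Mathlib

section
/- There exists a constant C > 0 such that for all smooth compactly supported maps u, v, w : ℝ² → ℝ², |b(u,v,w)| ≤ C (‖u‖₂² + ‖∇u‖₂²)^{1/2} (‖v‖₂² + ‖∇v‖₂²)^{1/2} (‖w‖₂² + ‖∇w‖₂²)^{1/2}; that is, the trilinear form b is continuous with respect to the H¹ norm. -/
open MeasureTheory

noncomputable section

/-- Partial derivative of a real-valued function on `ℝ²` in the `i`-th coordinate direction. -/
def pderivE (g : (Fin 2 → ℝ) → ℝ) (i : Fin 2) (x : Fin 2 → ℝ) : ℝ :=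
  fderiv ℝ g x (Pi.single i 1)

/-- The Navier–Stokes trilinear form
`b(u,v,w) = ∑ i j, ∫ u_i ∂_i v_j w_j`. -/
def formB (u v w : (Fin 2 → ℝ) → (Fin 2 → ℝ)) : ℝ :=
  ∑ i : Fin 2, ∑ j : Fin 2, ∫ x : Fin 2 → ℝ, u x i * pderivE (fun y => v y j) i x * w x j

/-- The Ericksen stress trilinear form
`m(θ₁,θ₂,u) = −∑ i j k, ∫ ∂_i θ₁^k ∂_j θ₂^k ∂_j u^i`. -/
def formM (t1 t2 u : (Fin 2 → ℝ) → (Fin 2 → ℝ)) : ℝ :=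
  -∑ i : Fin 2, ∑ j : Fin 2, ∑ k : Fin 2, ∫ x : Fin 2 → ℝ,
    pderivE (fun y => t1 y k) i x * pderivE (fun y => t2 y k) j x *
      pderivE (fun y => u y i) j x

/-- `u` is divergence-free: `∂₁u₁ + ∂₂u₂ = 0` everywhere. -/
def DivergenceFree (u : (Fin 2 → ℝ) → (Fin 2 → ℝ)) : Prop :=
  ∀ x, (∑ i : Fin 2, pderivE (fun y => u y i) i x) = 0

/-- The `L²` norm of an `ℝ²`-valued map. -/
def l2norm (g : (Fin 2 → ℝ) → (Fin 2 → ℝ)) : ℝ :=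
  (∫ x : Fin 2 → ℝ, ∑ k : Fin 2, (g x k) ^ 2) ^ (1/2 : ℝ)

/-- The `L²` norm of the gradient of an `ℝ²`-valued map. -/
def gradNorm (g : (Fin 2 → ℝ) → (Fin 2 → ℝ)) : ℝ :=
  (∫ x : Fin 2 → ℝ, ∑ i : Fin 2, ∑ k : Fin 2, (pderivE (fun y => g y k) i x) ^ 2) ^ (1/2 : ℝ)

/-- The `L²` norm of a real-valued function. -/
def l2normR (g : (Fin 2 → ℝ) → ℝ) : ℝ :=
  (∫ x : Fin 2 → ℝ, (g x) ^ 2) ^ (1/2 : ℝ)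

/-- The `L²` norm of the gradient of a real-valued function. -/
def gradNormR (g : (Fin 2 → ℝ) → ℝ) : ℝ :=
  (∫ x : Fin 2 → ℝ, ∑ i : Fin 2, (pderivE g i x) ^ 2) ^ (1/2 : ℝ)

/-- The `k`-th component of the (componentwise) Laplacian `Δg_k = ∂₁₁ g_k + ∂₂₂ g_k`. -/
def lapComp (g : (Fin 2 → ℝ) → (Fin 2 → ℝ)) (k : Fin 2) (x : Fin 2 → ℝ) : ℝ :=
  ∑ i : Fin 2, pderivE (pderivE (fun y => g y k) i) i x

/-- The `L²` norm of the componentwise Laplacian. -/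
def lapNorm (g : (Fin 2 → ℝ) → (Fin 2 → ℝ)) : ℝ :=
  (∫ x : Fin 2 → ℝ, ∑ k : Fin 2, (lapComp g k x) ^ 2) ^ (1/2 : ℝ)

/-- The `L^{4N+2}` norm of an `ℝ²`-valued map (written using `|v|^{4N+2} = (|v|²)^{2N+1}`). -/
def lqNorm (N : ℕ) (g : (Fin 2 → ℝ) → (Fin 2 → ℝ)) : ℝ :=
  (∫ x : Fin 2 → ℝ, (∑ k : Fin 2, (g x k) ^ 2) ^ (2 * N + 1)) ^ (1 / (4 * (N:ℝ) + 2))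

/-- The polynomial nonlinearity `f(θ) = (∑_{j=0}^{N} b_j |θ|^{2j}) θ`. -/
def polyF (N : ℕ) (b : Fin (N + 1) → ℝ) (v : Fin 2 → ℝ) : Fin 2 → ℝ :=
  fun k => (∑ j : Fin (N + 1), b j * (∑ l : Fin 2, (v l) ^ 2) ^ (j : ℕ)) * v k

theorem hasCompactSupport_sq {f : (Fin 2 → ℝ) → ℝ} (hf : HasCompactSupport f) :
    HasCompactSupport fun x => f x ^ 2 := by
  simp only [sq]
  exact hf.mul_right

/-- Cauchy–Schwarz for continuous compactly supported functions. -/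
theorem sq_integral_mul_le {f g : (Fin 2 → ℝ) → ℝ} (hf : Continuous f) (hf' : HasCompactSupport f)
    (hg : Continuous g) (hg' : HasCompactSupport g) :
    (∫ x, f x * g x) ^ 2 ≤ (∫ x, f x ^ 2) * ∫ x, g x ^ 2 := by
  have i1 : Integrable (fun x => f x ^ 2) :=
    (hf.pow 2).integrable_of_hasCompactSupport (hasCompactSupport_sq hf')
  have i2 : Integrable (fun x => g x ^ 2) :=
    (hg.pow 2).integrable_of_hasCompactSupport (hasCompactSupport_sq hg')
  have i3 : Integrable (fun x => f x * g x) :=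
    (hf.mul hg).integrable_of_hasCompactSupport hf'.mul_right
  have key : ∀ t : ℝ, 0 ≤ (∫ x, f x ^ 2) * (t * t) + (2 * ∫ x, f x * g x) * t
      + ∫ x, g x ^ 2 := by
    intro t
    have h0 : 0 ≤ ∫ x, (t * f x + g x) ^ 2 := integral_nonneg fun x => sq_nonneg _
    have h1 : (fun x => (t * f x + g x) ^ 2) =
        fun x => t * t * f x ^ 2 + 2 * t * (f x * g x) + g x ^ 2 := by
      funext x; ring
    have i4 : Integrable fun x => t * t * f x ^ 2 := i1.const_mul _
    have i5 : Integrable fun x => 2 * t * (f x * g x) := i3.const_mul _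
    have i6 : Integrable fun x => t * t * f x ^ 2 + 2 * t * (f x * g x) := i4.add i5
    rw [h1, integral_add i6 i2, integral_add i4 i5, integral_const_mul,
      integral_const_mul] at h0
    linarith
  have := discrim_le_zero key
  rw [discrim] at this
  linarith

theorem continuous_pderivE {g : (Fin 2 → ℝ) → ℝ} (hg : ContDiff ℝ 1 g) (i : Fin 2) :
    Continuous (pderivE g i) :=
  (hg.continuous_fderiv one_ne_zero).clm_apply continuous_const

theorem hasCompactSupport_pderivE {g : (Fin 2 → ℝ) → ℝ} (hg : HasCompactSupport g) (i : Fin 2) :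
    HasCompactSupport (pderivE g i) :=
  (hg.fderiv ℝ).comp_left (g := fun L : (Fin 2 → ℝ) →L[ℝ] ℝ => L (Pi.single i 1)) (by simp)

theorem norm_fderiv_le_sum_abs_pderivE (g : (Fin 2 → ℝ) → ℝ) (x : Fin 2 → ℝ) :
    ‖fderiv ℝ g x‖ ≤ ∑ i, |pderivE g i x| := by
  refine ContinuousLinearMap.opNorm_le_bound _ (by positivity) fun y => ?_
  have hy : y = ∑ i, y i • (Pi.single i (1 : ℝ) : Fin 2 → ℝ) := by
    funext j
    fin_cases j <;> simp [Pi.single_apply]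
  conv_lhs => rw [hy]
  rw [map_sum, Finset.sum_mul]
  refine (norm_sum_le _ _).trans (Finset.sum_le_sum fun i _ => ?_)
  rw [map_smul, norm_smul, mul_comm]
  exact mul_le_mul_of_nonneg_left (norm_le_pi_norm y i) (abs_nonneg _)

/-- The `L²` form of the Gagliardo–Nirenberg–Sobolev inequality on `ℝ²`. -/
theorem integral_sq_le_sq_integral_norm_fderiv {h : (Fin 2 → ℝ) → ℝ} (hh : ContDiff ℝ 1 h)
    (hh' : HasCompactSupport h) :
    ∫ x, h x ^ 2 ≤ (∫ x, ‖fderiv ℝ h x‖) ^ 2 := by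
  have hp : Real.HolderConjugate (Fintype.card (Fin 2)) 2 := by
    simpa using Real.HolderConjugate.two_two
  have key := lintegral_pow_le_pow_lintegral_fderiv_aux hp hh hh'
  have hi : Integrable (fun x => fderiv ℝ h x) :=
    (hh.continuous_fderiv one_ne_zero).integrable_of_hasCompactSupport (hh'.fderiv ℝ)
  have hi2 : Integrable (fun x => h x ^ 2) :=
    (hh.continuous.pow 2).integrable_of_hasCompactSupport
      (hasCompactSupport_sq hh')
  have e : ∀ x, ‖h x‖ₑ ^ (2 : ℝ) = ENNReal.ofReal (h x ^ 2) := by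
    intro x
    rw [ENNReal.rpow_two, Real.enorm_eq_ofReal_abs, ← ENNReal.ofReal_pow (abs_nonneg _), sq_abs]
  simp_rw [e] at key
  rw [← ofReal_integral_eq_lintegral_ofReal hi2 (.of_forall fun x => sq_nonneg _),
    ← ofReal_integral_norm_eq_lintegral_enorm hi, ENNReal.rpow_two,
    ← ENNReal.ofReal_pow (integral_nonneg fun x => norm_nonneg _)] at key
  exact (ENNReal.ofReal_le_ofReal_iff (by positivity)).1 key

/-- Ladyzhenskaya's inequality on `ℝ²`. -/
theorem integral_pow_four_le {g : (Fin 2 → ℝ) → ℝ} (hg : ContDiff ℝ 1 g)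
    (hg' : HasCompactSupport g) :
    ∫ x, g x ^ 4 ≤ 8 * (∫ x, g x ^ 2) * ∫ x, ∑ i, pderivE g i x ^ 2 := by
  have hs : HasCompactSupport fun x => g x ^ 2 :=
    hasCompactSupport_sq hg'
  have h1 := integral_sq_le_sq_integral_norm_fderiv (hg.pow 2) hs
  have hc : ∀ i, Continuous fun x => |pderivE g i x| := fun i => (continuous_pderivE hg i).abs
  have hc' : ∀ i, HasCompactSupport fun x => |pderivE g i x| := fun i =>
    (hasCompactSupport_pderivE hg' i).comp_left (g := fun y : ℝ => |y|) (by simp)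
  have hS : Continuous fun x => ∑ i, |pderivE g i x| := continuous_finsetSum _ fun i _ => hc i
  have hS' : HasCompactSupport fun x => ∑ i, |pderivE g i x| := by
    simp only [Fin.sum_univ_two]
    exact (hc' 0).add (hc' 1)
  have ha : Continuous fun x => |g x| := hg.continuous.abs
  have ha' : HasCompactSupport fun x => |g x| := hg'.comp_left (g := fun y : ℝ => |y|) (by simp)
  have h2 : ∫ x, ‖fderiv ℝ (fun x => g x ^ 2) x‖ ≤ 2 * ∫ x, |g x| * ∑ i, |pderivE g i x| := by
    rw [← integral_const_mul]
    refine integral_mono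
      (((hg.pow 2).continuous_fderiv one_ne_zero).norm.integrable_of_hasCompactSupport
        (hs.fderiv ℝ).norm)
      (((ha.mul hS).integrable_of_hasCompactSupport ha'.mul_right).const_mul _) fun x => ?_
    have hd : fderiv ℝ (fun x => g x ^ 2) x = (2 * g x) • fderiv ℝ g x := by
      simpa using (((hg.differentiable one_ne_zero) x).hasFDerivAt.pow 2).fderiv
    simp only [hd, norm_smul, Real.norm_eq_abs, abs_mul, abs_two, mul_assoc]
    gcongr
    exact norm_fderiv_le_sum_abs_pderivE g x
  have h3 := sq_integral_mul_le ha ha' hS hS'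
  have h4 : ∫ x, (∑ i, |pderivE g i x|) ^ 2 ≤ 2 * ∫ x, ∑ i, pderivE g i x ^ 2 := by
    rw [← integral_const_mul]
    refine integral_mono ((hS.pow 2).integrable_of_hasCompactSupport
      (hasCompactSupport_sq hS'))
      ((integrable_finsetSum _ fun i _ => ?_).const_mul _) fun x => ?_
    · exact ((continuous_pderivE hg i).pow 2).integrable_of_hasCompactSupport
        (hasCompactSupport_sq (hasCompactSupport_pderivE hg' i))
    · simp only [Fin.sum_univ_two]
      nlinarith [sq_nonneg (|pderivE g 0 x| - |pderivE g 1 x|), sq_abs (pderivE g 0 x),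
        sq_abs (pderivE g 1 x)]
  have h5 : 0 ≤ ∫ x, ‖fderiv ℝ (fun x => g x ^ 2) x‖ := integral_nonneg fun x => norm_nonneg _
  have h6 : 0 ≤ ∫ x, g x ^ 2 := integral_nonneg fun x => sq_nonneg _
  simp only [sq_abs] at h3
  calc ∫ x, g x ^ 4 = ∫ x, (g x ^ 2) ^ 2 := by simp only [← pow_mul]
    _ ≤ (2 * ∫ x, |g x| * ∑ i, |pderivE g i x|) ^ 2 := h1.trans (pow_le_pow_left₀ h5 h2 2)
    _ ≤ 4 * ((∫ x, g x ^ 2) * ∫ x, (∑ i, |pderivE g i x|) ^ 2) := by linarith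
    _ ≤ 4 * ((∫ x, g x ^ 2) * (2 * ∫ x, ∑ i, pderivE g i x ^ 2)) := by gcongr
    _ = _ := by ring

theorem sq_integral_mul_mul_le {f p g : (Fin 2 → ℝ) → ℝ} {a b c : ℝ} (ha : 0 ≤ a) (hc : 0 ≤ c)
    (hf : Continuous f) (hf' : HasCompactSupport f) (hp : Continuous p)
    (hp' : HasCompactSupport p) (hg : Continuous g) (hg' : HasCompactSupport g)
    (hfa : ∫ x, f x ^ 4 ≤ 2 * a ^ 2) (hpb : ∫ x, p x ^ 2 ≤ b) (hgc : ∫ x, g x ^ 4 ≤ 2 * c ^ 2) :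
    (∫ x, f x * p x * g x) ^ 2 ≤ 2 * a * b * c := by
  have h1 : (∫ x, p x * (f x * g x)) ^ 2 ≤ (∫ x, p x ^ 2) * ∫ x, (f x * g x) ^ 2 :=
    sq_integral_mul_le hp hp' (hf.mul hg) hf'.mul_right
  have h2 : (∫ x, f x ^ 2 * g x ^ 2) ^ 2 ≤ (∫ x, (f x ^ 2) ^ 2) * ∫ x, (g x ^ 2) ^ 2 :=
    sq_integral_mul_le (hf.pow 2) (hasCompactSupport_sq hf') (hg.pow 2) (hasCompactSupport_sq hg')
  simp only [mul_pow] at h1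
  simp only [← pow_mul, Nat.reduceMul] at h2
  have e : (fun x => f x * p x * g x) = fun x => p x * (f x * g x) := by
    funext x
    ring
  rw [e]
  have h3 : 0 ≤ ∫ x, g x ^ 4 := integral_nonneg fun x => by positivity
  have h4 : 0 ≤ ∫ x, p x ^ 2 := integral_nonneg fun x => by positivity
  have h5 : ∫ x, f x ^ 2 * g x ^ 2 ≤ 2 * a * c := by
    refine le_of_sq_le_sq ?_ (by positivity)
    calc _ ≤ _ := h2
      _ ≤ 2 * a ^ 2 * (2 * c ^ 2) := by gcongr
      _ = _ := by ring
  calc _ ≤ _ := h1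
    _ ≤ b * (2 * a * c) := by
      have : 0 ≤ ∫ x, f x ^ 2 * g x ^ 2 := integral_nonneg fun x => by positivity
      gcongr
      exact h4.trans hpb
    _ = _ := by ring

theorem l2norm_sq (g : (Fin 2 → ℝ) → (Fin 2 → ℝ)) :
    l2norm g ^ 2 = ∫ x, ∑ k, g x k ^ 2 := by
  rw [l2norm, ← Real.sqrt_eq_rpow, Real.sq_sqrt (integral_nonneg fun x => by positivity)]

theorem gradNorm_sq (g : (Fin 2 → ℝ) → (Fin 2 → ℝ)) :
    gradNorm g ^ 2 = ∫ x, ∑ i, ∑ k, pderivE (fun y => g y k) i x ^ 2 := by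
  rw [gradNorm, ← Real.sqrt_eq_rpow, Real.sq_sqrt (integral_nonneg fun x => by positivity)]

section Components

variable {g : (Fin 2 → ℝ) → (Fin 2 → ℝ)}

theorem hasCompactSupport_component (hg : HasCompactSupport g) (k : Fin 2) :
    HasCompactSupport fun y => g y k :=
  hg.comp_left (g := fun y : Fin 2 → ℝ => y k) rfl

theorem integrable_component_sq (hg : Continuous g) (hg' : HasCompactSupport g) (k : Fin 2) :
    Integrable fun x => g x k ^ 2 :=
  (((continuous_apply k).comp hg).pow 2).integrable_of_hasCompactSupport
    (hasCompactSupport_sq (hasCompactSupport_component hg' k))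

theorem integrable_pderivE_component_sq (hg : ContDiff ℝ 1 g) (hg' : HasCompactSupport g)
    (i k : Fin 2) : Integrable fun x => pderivE (fun y => g y k) i x ^ 2 :=
  ((continuous_pderivE (contDiff_pi.1 hg k) i).pow 2).integrable_of_hasCompactSupport
    (hasCompactSupport_sq (hasCompactSupport_pderivE (hasCompactSupport_component hg' k) i))

theorem integral_component_sq_le (hg : Continuous g) (hg' : HasCompactSupport g) (k : Fin 2) :
    ∫ x, g x k ^ 2 ≤ l2norm g ^ 2 := by
  rw [l2norm_sq]
  exact integral_mono (integrable_component_sq hg hg' k)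
    (integrable_finsetSum _ fun i _ => integrable_component_sq hg hg' i)
    fun x => Finset.single_le_sum (f := fun k => g x k ^ 2) (fun _ _ => sq_nonneg _)
      (Finset.mem_univ k)

theorem integral_grad_component_sq_le (hg : ContDiff ℝ 1 g) (hg' : HasCompactSupport g)
    (k : Fin 2) : ∫ x, ∑ i, pderivE (fun y => g y k) i x ^ 2 ≤ gradNorm g ^ 2 := by
  rw [gradNorm_sq]
  exact integral_mono (integrable_finsetSum _ fun i _ => integrable_pderivE_component_sq hg hg' i k)
    (integrable_finsetSum _ fun i _ => integrable_finsetSum _ fun j _ =>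
      integrable_pderivE_component_sq hg hg' i j)
    fun x => Finset.sum_le_sum fun i _ =>
      Finset.single_le_sum (f := fun k => pderivE (fun y => g y k) i x ^ 2)
        (fun _ _ => sq_nonneg _) (Finset.mem_univ k)

theorem integral_pderivE_component_sq_le (hg : ContDiff ℝ 1 g) (hg' : HasCompactSupport g)
    (i k : Fin 2) : ∫ x, pderivE (fun y => g y k) i x ^ 2 ≤ gradNorm g ^ 2 :=
  (integral_mono (integrable_pderivE_component_sq hg hg' i k)
    (integrable_finsetSum _ fun j _ => integrable_pderivE_component_sq hg hg' j k)
    fun x => Finset.single_le_sum (f := fun i => pderivE (fun y => g y k) i x ^ 2)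
      (fun _ _ => sq_nonneg _) (Finset.mem_univ i)).trans (integral_grad_component_sq_le hg hg' k)

theorem integral_component_pow_four_le (hg : ContDiff ℝ 1 g) (hg' : HasCompactSupport g)
    (k : Fin 2) : ∫ x, g x k ^ 4 ≤ 2 * (l2norm g ^ 2 + gradNorm g ^ 2) ^ 2 := by
  have h1 := integral_pow_four_le (contDiff_pi.1 hg k) (hasCompactSupport_component hg' k)
  have h2 : 0 ≤ ∫ x, ∑ i, pderivE (fun y => g y k) i x ^ 2 :=
    integral_nonneg fun x => by positivity
  calc _ ≤ _ := h1
    _ ≤ 8 * l2norm g ^ 2 * gradNorm g ^ 2 := by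
      gcongr
      · exact integral_component_sq_le hg.continuous hg' k
      · exact integral_grad_component_sq_le hg hg' k
    _ ≤ _ := by nlinarith [sq_nonneg (l2norm g ^ 2 - gradNorm g ^ 2)]

end Components

/-- continuity of the trilinear form `b` with respect to the `H¹` norm. -/
theorem formB_continuous_H1 :
    ∃ C > (0:ℝ), ∀ u v w : (Fin 2 → ℝ) → (Fin 2 → ℝ),
      ContDiff ℝ (⊤ : ℕ∞) u → HasCompactSupport u →
      ContDiff ℝ (⊤ : ℕ∞) v → HasCompactSupport v →
      ContDiff ℝ (⊤ : ℕ∞) w → HasCompactSupport w →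
      |formB u v w| ≤
        C * ((l2norm u) ^ 2 + (gradNorm u) ^ 2) ^ (1/2 : ℝ)
          * ((l2norm v) ^ 2 + (gradNorm v) ^ 2) ^ (1/2 : ℝ)
          * ((l2norm w) ^ 2 + (gradNorm w) ^ 2) ^ (1/2 : ℝ) := by
  refine ⟨8, by norm_num, fun u v w hu hu' hv hv' hw hw' => ?_⟩
  have hu1 : ContDiff ℝ 1 u := hu.of_le (by exact_mod_cast le_top)
  have hv1 : ContDiff ℝ 1 v := hv.of_le (by exact_mod_cast le_top)
  have hw1 : ContDiff ℝ 1 w := hw.of_le (by exact_mod_cast le_top)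
  simp only [← Real.sqrt_eq_rpow]
  set a := l2norm u ^ 2 + gradNorm u ^ 2 with ha
  set b := l2norm v ^ 2 + gradNorm v ^ 2 with hb
  set c := l2norm w ^ 2 + gradNorm w ^ 2 with hc
  have ha0 : 0 ≤ a := by positivity
  have hb0 : 0 ≤ b := by positivity
  have hc0 : 0 ≤ c := by positivity
  have key : ∀ i j : Fin 2, |∫ x, u x i * pderivE (fun y => v y j) i x * w x j| ≤
      2 * √a * √b * √c := by
    intro i j
    refine abs_le_of_sq_le_sq ?_ (by positivity)
    have h := sq_integral_mul_mul_le ha0 hc0 ((continuous_apply i).comp hu.continuous)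
      (hasCompactSupport_component hu' i) (continuous_pderivE (contDiff_pi.1 hv1 j) i)
      (hasCompactSupport_pderivE (hasCompactSupport_component hv' j) i)
      ((continuous_apply j).comp hw.continuous) (hasCompactSupport_component hw' j)
      (integral_component_pow_four_le hu1 hu' i)
      ((integral_pderivE_component_sq_le hv1 hv' i j).trans
        (le_add_of_nonneg_left (sq_nonneg (l2norm v))))
      (integral_component_pow_four_le hw1 hw' j)
    rw [mul_pow, mul_pow, mul_pow, Real.sq_sqrt ha0, Real.sq_sqrt hb0, Real.sq_sqrt hc0]
    have : 0 ≤ a * b * c := by positivity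
    refine h.trans ?_
    linarith
  calc |formB u v w| ≤ ∑ _i : Fin 2, ∑ _j : Fin 2, 2 * √a * √b * √c :=
        (Finset.abs_sum_le_sum_abs _ _).trans (Finset.sum_le_sum fun i _ =>
          (Finset.abs_sum_le_sum_abs _ _).trans (Finset.sum_le_sum fun j _ => key i j))
    _ = 8 * √a * √b * √c := by
      simp only [Fin.sum_univ_two]
      ring

end
end

section
/- There exists a constant C > 0 such that for all smooth compactly supported maps θ₁, θ₂ : ℝ² → ℝ² and u : ℝ² → ℝ², |m(θ₁,θ₂,u)| ≤ C ‖∇θ₁‖₂^{1/2} ‖Δθ₁‖₂^{1/2} ‖∇θ₂‖₂^{1/2} ‖Δθ₂‖₂^{1/2} ‖∇u‖₂. -/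
open MeasureTheory

noncomputable section

/-- **Cauchy–Schwarz inequality** for integrals of real functions, in squared form. -/
theorem sq_integral_mul_le_s7 {α : Type*} [MeasurableSpace α] {μ : Measure α} {f g : α → ℝ}
    (hf : Integrable (fun x => f x ^ 2) μ) (hg : Integrable (fun x => g x ^ 2) μ)
    (hfg : Integrable (fun x => f x * g x) μ) :
    (∫ x, f x * g x ∂μ) ^ 2 ≤ (∫ x, f x ^ 2 ∂μ) * ∫ x, g x ^ 2 ∂μ := by
  have key : discrim (∫ x, f x ^ 2 ∂μ) (2 * ∫ x, f x * g x ∂μ) (∫ x, g x ^ 2 ∂μ) ≤ 0 := by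
    refine discrim_le_zero fun t => ?_
    have h : 0 ≤ ∫ x, (t * t * f x ^ 2 + 2 * t * (f x * g x)) + g x ^ 2 ∂μ :=
      integral_nonneg fun x => by
        have : 0 ≤ (t * f x + g x) ^ 2 := sq_nonneg _
        simp only [Pi.zero_apply]
        linarith
    have hI : Integrable (fun x => t * t * f x ^ 2 + 2 * t * (f x * g x)) μ :=
      (hf.const_mul _).add (hfg.const_mul _)
    rw [integral_add hI hg,
      integral_add (hf.const_mul _) (hfg.const_mul _), integral_const_mul, integral_const_mul] at h
    linarith
  rw [discrim] at key
  linarith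

theorem contDiff_pderivE {g : (Fin 2 → ℝ) → ℝ} (hg : ContDiff ℝ (⊤ : ℕ∞) g) (i : Fin 2) :
    ContDiff ℝ (⊤ : ℕ∞) (pderivE g i) :=
  (hg.fderiv_right (by simp)).clm_apply contDiff_const

theorem pderivE_comm {g : (Fin 2 → ℝ) → ℝ} (hg : ContDiff ℝ (⊤ : ℕ∞) g) (i j : Fin 2) :
    pderivE (pderivE g i) j = pderivE (pderivE g j) i := by
  have hd : Differentiable ℝ (fderiv ℝ g) :=
    (hg.fderiv_right (m := (⊤ : ℕ∞)) (by simp)).differentiable (by simp)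
  have h2 : ∀ (v : Fin 2 → ℝ) (x w : Fin 2 → ℝ),
      fderiv ℝ (fun y => fderiv ℝ g y v) x w = fderiv ℝ (fderiv ℝ g) x w v := fun v x w => by
    rw [fderiv_clm_apply (hd x) (differentiableAt_const v)]
    simp
  funext x
  have hs : IsSymmSndFDerivAt ℝ g x := hg.contDiffAt.isSymmSndFDerivAt (by
    rw [minSmoothness_of_isRCLikeNormedField]
    exact WithTop.coe_le_coe.2 le_top)
  exact (h2 _ x _).trans ((hs _ _).trans (h2 _ x _).symm)

theorem integrable_mul_of_hasCompactSupport_left {f g : (Fin 2 → ℝ) → ℝ} (hf : Continuous f)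
    (hfc : HasCompactSupport f) (hg : Continuous g) : Integrable (fun x => f x * g x) :=
  (hf.mul hg).integrable_of_hasCompactSupport hfc.mul_right

theorem integrable_pow_of_hasCompactSupport {f : (Fin 2 → ℝ) → ℝ} (hf : Continuous f)
    (hfc : HasCompactSupport f) {n : ℕ} (hn : n ≠ 0) : Integrable (fun x => f x ^ n) :=
  (hf.pow n).integrable_of_hasCompactSupport
    (hfc.comp_left (g := fun y : ℝ => y ^ n) (zero_pow hn))

/-- Integration by parts for the partial derivatives on `ℝ²`. -/
theorem integral_mul_pderivE {f g : (Fin 2 → ℝ) → ℝ} (hf : ContDiff ℝ (⊤ : ℕ∞) f)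
    (hfc : HasCompactSupport f) (hg : ContDiff ℝ (⊤ : ℕ∞) g) (i : Fin 2) :
    ∫ x, f x * pderivE g i x = -∫ x, pderivE f i x * g x :=
  integral_mul_fderiv_eq_neg_fderiv_mul_of_integrable
    (integrable_mul_of_hasCompactSupport_left (contDiff_pderivE hf i).continuous
      (hasCompactSupport_pderivE hfc i) hg.continuous)
    (integrable_mul_of_hasCompactSupport_left hf.continuous hfc (contDiff_pderivE hg i).continuous)
    (integrable_mul_of_hasCompactSupport_left hf.continuous hfc hg.continuous)
    (fun x _ => hf.differentiable (by simp) x) (fun x _ => hg.differentiable (by simp) x)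

theorem integral_pderivE_mul_pderivE_comm {f g : (Fin 2 → ℝ) → ℝ} (hf : ContDiff ℝ (⊤ : ℕ∞) f)
    (hfc : HasCompactSupport f) (hg : ContDiff ℝ (⊤ : ℕ∞) g) (i j : Fin 2) :
    ∫ x, pderivE f i x * pderivE g j x = ∫ x, pderivE f j x * pderivE g i x := by
  have h1 := integral_mul_pderivE hf hfc (contDiff_pderivE hg j) i
  have h2 := integral_mul_pderivE hf hfc (contDiff_pderivE hg i) j
  rw [pderivE_comm hg j i] at h1
  linarith

/-- The `L²` norm of the Hessian of a test function on `ℝ²` equals that of its Laplacian. -/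
theorem integral_hessian_sq_eq {f : (Fin 2 → ℝ) → ℝ} (hf : ContDiff ℝ (⊤ : ℕ∞) f)
    (hfc : HasCompactSupport f) :
    ∑ i : Fin 2, ∑ j : Fin 2, ∫ x, pderivE (pderivE f i) j x ^ 2 =
      ∫ x, (∑ i : Fin 2, pderivE (pderivE f i) i x) ^ 2 := by
  have hC : ∀ i j, Continuous (pderivE (pderivE f i) j) := fun i j =>
    (contDiff_pderivE (contDiff_pderivE hf i) j).continuous
  have hS : ∀ i j, HasCompactSupport (pderivE (pderivE f i) j) := fun i j =>
    hasCompactSupport_pderivE (hasCompactSupport_pderivE hfc i) j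
  have hI : ∀ i j, Integrable (fun x => pderivE (pderivE f i) j x ^ 2) := fun i j =>
    integrable_pow_of_hasCompactSupport (hC i j) (hS i j) two_ne_zero
  have hI' : Integrable (fun x => 2 * (pderivE (pderivE f 0) 0 x * pderivE (pderivE f 1) 1 x)) :=
    (integrable_mul_of_hasCompactSupport_left (hC 0 0) (hS 0 0) (hC 1 1)).const_mul 2
  have hI'' : Integrable (fun x => pderivE (pderivE f 0) 0 x ^ 2 +
      2 * (pderivE (pderivE f 0) 0 x * pderivE (pderivE f 1) 1 x)) := (hI 0 0).add hI'
  have hcross := integral_pderivE_mul_pderivE_comm (contDiff_pderivE hf 0)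
    (hasCompactSupport_pderivE hfc 0) (contDiff_pderivE hf 1) 0 1
  have hexp : ∀ x, (∑ i : Fin 2, pderivE (pderivE f i) i x) ^ 2 =
      (pderivE (pderivE f 0) 0 x ^ 2 +
        2 * (pderivE (pderivE f 0) 0 x * pderivE (pderivE f 1) 1 x)) +
        pderivE (pderivE f 1) 1 x ^ 2 := fun x => by
    rw [Fin.sum_univ_two]
    ring
  simp_rw [hexp]
  rw [integral_add hI'' (hI 1 1), integral_add (hI 0 0) hI', integral_const_mul,
    hcross, pderivE_comm hf 1 0]
  simp only [Fin.sum_univ_two, pderivE_comm hf 1 0, ← sq]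
  ring

theorem norm_le_sum_abs_apply_single (L : (Fin 2 → ℝ) →L[ℝ] ℝ) :
    ‖L‖ ≤ |L (Pi.single 0 1)| + |L (Pi.single 1 1)| := by
  refine L.opNorm_le_bound (by positivity) fun v => ?_
  have hv : v = v 0 • Pi.single 0 1 + v 1 • Pi.single 1 1 := by
    ext i
    fin_cases i <;> simp
  have h0 : |v 0| ≤ ‖v‖ := norm_le_pi_norm v 0
  have h1 : |v 1| ≤ ‖v‖ := norm_le_pi_norm v 1
  have hL : L v = v 0 * L (Pi.single 0 1) + v 1 * L (Pi.single 1 1) := by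
    conv_lhs => rw [hv]
    simp
  calc ‖L v‖ ≤ |v 0| * |L (Pi.single 0 1)| + |v 1| * |L (Pi.single 1 1)| := by
        rw [hL, Real.norm_eq_abs, ← abs_mul, ← abs_mul]
        exact abs_add_le _ _
    _ ≤ ‖v‖ * |L (Pi.single 0 1)| + ‖v‖ * |L (Pi.single 1 1)| := by gcongr
    _ = _ := by ring

/-- The **Gagliardo–Nirenberg–Sobolev inequality** on `ℝ²`, with real-valued integrals. -/
theorem exists_integral_sq_le_sq_integral_norm_fderiv :
    ∃ K : ℝ, 0 ≤ K ∧ ∀ f : (Fin 2 → ℝ) → ℝ, ContDiff ℝ 1 f → HasCompactSupport f →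
      ∫ x, f x ^ 2 ≤ K * (∫ x, ‖fderiv ℝ f x‖) ^ 2 := by
  refine ⟨lintegralPowLePowLIntegralFDerivConst (volume : Measure (Fin 2 → ℝ)) 2,
    NNReal.coe_nonneg _, fun f hf hfc => ?_⟩
  have hp : Real.HolderConjugate (Module.finrank ℝ (Fin 2 → ℝ)) 2 := by
    rw [Module.finrank_fintype_fun_eq_card, Fintype.card_fin]
    exact_mod_cast Real.HolderConjugate.two_two
  have h := lintegral_pow_le_pow_lintegral_fderiv (volume : Measure (Fin 2 → ℝ)) hf hfc hp
  have hI : Integrable (fderiv ℝ f) :=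
    (hf.continuous_fderiv (by simp)).integrable_of_hasCompactSupport (hfc.fderiv (𝕜 := ℝ))
  have hl : ∫⁻ x, ‖f x‖ₑ ^ (2 : ℝ) = ENNReal.ofReal (∫ x, f x ^ 2) := by
    rw [ofReal_integral_eq_lintegral_ofReal
      (integrable_pow_of_hasCompactSupport hf.continuous hfc two_ne_zero)
      (Filter.Eventually.of_forall fun x => sq_nonneg _)]
    refine lintegral_congr fun x => ?_
    rw [ENNReal.rpow_ofNat, ← ofReal_norm, ← ENNReal.ofReal_pow (norm_nonneg _),
      Real.norm_eq_abs, sq_abs]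
  rw [hl, ← ofReal_integral_norm_eq_lintegral_enorm hI, ENNReal.rpow_ofNat,
    ← ENNReal.ofReal_pow (integral_nonneg fun _ => norm_nonneg _), ← ENNReal.ofReal_coe_nnreal,
    ← ENNReal.ofReal_mul (NNReal.coe_nonneg _)] at h
  exact (ENNReal.ofReal_le_ofReal_iff (by positivity)).1 h

/-- **Ladyzhenskaya's inequality** on `ℝ²`. -/
theorem exists_integral_pow_four_le :
    ∃ K : ℝ, 0 ≤ K ∧ ∀ g : (Fin 2 → ℝ) → ℝ, ContDiff ℝ (⊤ : ℕ∞) g → HasCompactSupport g →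
      ∫ x, g x ^ 4 ≤ K * ((∫ x, g x ^ 2) * ∑ i : Fin 2, ∫ x, pderivE g i x ^ 2) := by
  obtain ⟨K, hK, hKf⟩ := exists_integral_sq_le_sq_integral_norm_fderiv
  refine ⟨K * 8, by positivity, fun g hg hgc => ?_⟩
  have hg1 : ContDiff ℝ 1 g := hg.of_le (by simp)
  have hsq : HasCompactSupport (fun x => g x ^ 2) :=
    hgc.comp_left (g := fun y : ℝ => y ^ 2) (by simp)
  have hS := hKf (fun x => g x ^ 2) (hg1.pow 2) hsq
  simp_rw [← pow_mul] at hS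
  have hc : ∀ i, Continuous (pderivE g i) := fun i => (contDiff_pderivE hg i).continuous
  have hi : ∀ i, Integrable (fun x => pderivE g i x ^ 2) := fun i =>
    integrable_pow_of_hasCompactSupport (hc i) (hasCompactSupport_pderivE hgc i) two_ne_zero
  set h : (Fin 2 → ℝ) → ℝ := fun x => 2 * (|pderivE g 0 x| + |pderivE g 1 x|) with hh
  have hhc : Continuous h := continuous_const.mul ((hc 0).abs.add (hc 1).abs)
  have hhs : HasCompactSupport h :=
    (((hasCompactSupport_pderivE hgc 0).comp_left (g := fun y : ℝ => |y|) abs_zero).add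
      ((hasCompactSupport_pderivE hgc 1).comp_left (g := fun y : ℝ => |y|) abs_zero)).mul_left
  have hga : HasCompactSupport (fun x => |g x|) :=
    hgc.comp_left (g := fun y : ℝ => |y|) abs_zero
  have hmul : Integrable (fun x => |g x| * h x) :=
    integrable_mul_of_hasCompactSupport_left hg.continuous.abs hga hhc
  have hpt : ∀ x, ‖fderiv ℝ (fun y => g y ^ 2) x‖ ≤ |g x| * h x := fun x => by
    rw [fderiv_fun_pow 2 (hg1.differentiable (by simp) x), norm_smul]
    have hn : ‖fderiv ℝ g x‖ ≤ |pderivE g 0 x| + |pderivE g 1 x| :=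
      norm_le_sum_abs_apply_single _
    calc _ = 2 * |g x| * ‖fderiv ℝ g x‖ := by simp
      _ ≤ 2 * |g x| * (|pderivE g 0 x| + |pderivE g 1 x|) := by gcongr
      _ = _ := by rw [hh]; ring
  have h1 : ∫ x, ‖fderiv ℝ (fun y => g y ^ 2) x‖ ≤ ∫ x, |g x| * h x :=
    integral_mono_of_nonneg (Filter.Eventually.of_forall fun _ => norm_nonneg _) hmul
      (Filter.Eventually.of_forall hpt)
  have hcs := sq_integral_mul_le_s7
    (integrable_pow_of_hasCompactSupport hg.continuous.abs hga two_ne_zero)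
    (integrable_pow_of_hasCompactSupport hhc hhs two_ne_zero) hmul
  simp only [sq_abs] at hcs
  have h2 : ∫ x, h x ^ 2 ≤ 8 * ∑ i : Fin 2, ∫ x, pderivE g i x ^ 2 := by
    rw [Fin.sum_univ_two, ← integral_add (hi 0) (hi 1), ← integral_const_mul]
    refine integral_mono (integrable_pow_of_hasCompactSupport hhc hhs two_ne_zero)
      (((hi 0).add (hi 1)).const_mul 8) fun x => ?_
    simp only [hh]
    nlinarith [sq_nonneg (|pderivE g 0 x| - |pderivE g 1 x|), sq_abs (pderivE g 0 x),
      sq_abs (pderivE g 1 x)]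
  calc _ ≤ K * (∫ x, ‖fderiv ℝ (fun y => g y ^ 2) x‖) ^ 2 := hS
    _ ≤ K * (∫ x, |g x| * h x) ^ 2 := by gcongr
    _ ≤ K * ((∫ x, g x ^ 2) * ∫ x, h x ^ 2) := by gcongr
    _ ≤ K * ((∫ x, g x ^ 2) * (8 * ∑ i : Fin 2, ∫ x, pderivE g i x ^ 2)) := by gcongr
    _ = _ := by ring

theorem gradNorm_nonneg (g : (Fin 2 → ℝ) → (Fin 2 → ℝ)) : 0 ≤ gradNorm g := by
  unfold gradNorm
  positivity

theorem lapNorm_nonneg (g : (Fin 2 → ℝ) → (Fin 2 → ℝ)) : 0 ≤ lapNorm g := by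
  unfold lapNorm
  positivity

theorem integral_pderivE_sq_le_gradNorm_sq {g : (Fin 2 → ℝ) → (Fin 2 → ℝ)}
    (hg : ContDiff ℝ (⊤ : ℕ∞) g) (hgc : HasCompactSupport g) (i k : Fin 2) :
    ∫ x, pderivE (fun y => g y k) i x ^ 2 ≤ gradNorm g ^ 2 := by
  have hI : ∀ i k, Integrable (fun x => pderivE (fun y => g y k) i x ^ 2) := fun i k =>
    integrable_pow_of_hasCompactSupport (contDiff_pderivE (contDiff_pi.1 hg k) i).continuous
      (hasCompactSupport_pderivE (hgc.comp_left (g := fun v : Fin 2 → ℝ => v k) rfl) i) two_ne_zero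
  rw [gradNorm, ← Real.sqrt_eq_rpow, Real.sq_sqrt (integral_nonneg fun x => by positivity)]
  refine integral_mono (hI i k)
    (integrable_finsetSum _ fun i _ => integrable_finsetSum _ fun k _ => hI i k) fun x => ?_
  calc pderivE (fun y => g y k) i x ^ 2 ≤ ∑ k, pderivE (fun y => g y k) i x ^ 2 :=
        Finset.single_le_sum (f := fun k => pderivE (fun y => g y k) i x ^ 2)
          (fun _ _ => sq_nonneg _) (Finset.mem_univ k)
    _ ≤ _ := Finset.single_le_sum (f := fun i => ∑ k, pderivE (fun y => g y k) i x ^ 2)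
          (fun _ _ => by positivity) (Finset.mem_univ i)

theorem sum_integral_pderivE_pderivE_sq_le_lapNorm_sq {g : (Fin 2 → ℝ) → (Fin 2 → ℝ)}
    (hg : ContDiff ℝ (⊤ : ℕ∞) g) (hgc : HasCompactSupport g) (i k : Fin 2) :
    ∑ j : Fin 2, ∫ x, pderivE (pderivE (fun y => g y k) i) j x ^ 2 ≤ lapNorm g ^ 2 := by
  have hc : ∀ k, ContDiff ℝ (⊤ : ℕ∞) (fun y => g y k) := contDiff_pi.1 hg
  have hs : ∀ k, HasCompactSupport (fun y => g y k) := fun k =>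
    hgc.comp_left (g := fun v : Fin 2 → ℝ => v k) rfl
  have hI : ∀ k, Integrable (fun x => lapComp g k x ^ 2) := fun k => by
    refine integrable_pow_of_hasCompactSupport (f := lapComp g k)
      (continuous_finsetSum _ fun i _ =>
        (contDiff_pderivE (contDiff_pderivE (hc k) i) i).continuous) ?_ two_ne_zero
    have h := fun i => hasCompactSupport_pderivE (hasCompactSupport_pderivE (hs k) i) i
    have hsum : lapComp g k = pderivE (pderivE (fun y => g y k) 0) 0 +
        pderivE (pderivE (fun y => g y k) 1) 1 := by
      funext x
      simp [lapComp]
    exact hsum ▸ (h 0).add (h 1)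
  rw [lapNorm, ← Real.sqrt_eq_rpow, Real.sq_sqrt (integral_nonneg fun x => by positivity)]
  calc ∑ j : Fin 2, ∫ x, pderivE (pderivE (fun y => g y k) i) j x ^ 2
      ≤ ∑ i : Fin 2, ∑ j : Fin 2, ∫ x, pderivE (pderivE (fun y => g y k) i) j x ^ 2 :=
        Finset.single_le_sum
          (f := fun i => ∑ j : Fin 2, ∫ x, pderivE (pderivE (fun y => g y k) i) j x ^ 2)
          (fun _ _ => Finset.sum_nonneg fun _ _ => integral_nonneg fun _ => sq_nonneg _)
          (Finset.mem_univ i)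
    _ = ∫ x, lapComp g k x ^ 2 := integral_hessian_sq_eq (hc k) (hs k)
    _ ≤ _ := integral_mono (hI k) (integrable_finsetSum _ fun k _ => hI k) fun x =>
        Finset.single_le_sum (f := fun k => lapComp g k x ^ 2) (fun _ _ => sq_nonneg _)
          (Finset.mem_univ k)

/-- Hölder's inequality with exponents `4, 4, 2`, raised to the fourth power. -/
theorem integral_mul_mul_pow_four_le {a b c : (Fin 2 → ℝ) → ℝ} (ha : Continuous a)
    (hac : HasCompactSupport a) (hb : Continuous b) (hbc : HasCompactSupport b)
    (hc : Continuous c) (hcc : HasCompactSupport c) :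
    (∫ x, a x * b x * c x) ^ 4 ≤
      (∫ x, a x ^ 4) * (∫ x, b x ^ 4) * (∫ x, c x ^ 2) ^ 2 := by
  have hab : HasCompactSupport (fun x => a x * b x) := hac.mul_right
  have ha2 : HasCompactSupport (fun x => a x ^ 2) :=
    hac.comp_left (g := fun y : ℝ => y ^ 2) (by simp)
  have h1 := sq_integral_mul_le_s7 (f := fun x => a x * b x)
    (integrable_pow_of_hasCompactSupport (ha.mul hb) hab two_ne_zero)
    (integrable_pow_of_hasCompactSupport hc hcc two_ne_zero)
    (integrable_mul_of_hasCompactSupport_left (ha.mul hb) hab hc)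
  have hsq : ∀ {f : (Fin 2 → ℝ) → ℝ}, Continuous f → HasCompactSupport f →
      Integrable (fun x => (f x ^ 2) ^ 2) := fun {f} hf hfc => by
    simp_rw [← pow_mul]
    exact integrable_pow_of_hasCompactSupport hf hfc (by norm_num)
  have h2 := sq_integral_mul_le_s7 (hsq ha hac) (hsq hb hbc)
    (integrable_mul_of_hasCompactSupport_left (ha.pow 2) ha2 (hb.pow 2))
  simp_rw [← pow_mul, ← mul_pow] at h2
  calc (∫ x, a x * b x * c x) ^ 4 = ((∫ x, a x * b x * c x) ^ 2) ^ 2 := by ring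
    _ ≤ ((∫ x, (a x * b x) ^ 2) * ∫ x, c x ^ 2) ^ 2 := by gcongr
    _ = (∫ x, (a x * b x) ^ 2) ^ 2 * (∫ x, c x ^ 2) ^ 2 := by ring
    _ ≤ _ := by gcongr

/-- the Ericksen stress estimate
`|m(θ₁,θ₂,u)| ≤ C ‖∇θ₁‖₂^{1/2} ‖Δθ₁‖₂^{1/2} ‖∇θ₂‖₂^{1/2} ‖Δθ₂‖₂^{1/2} ‖∇u‖₂`. -/
theorem formM_estimate :
    ∃ C > (0:ℝ), ∀ t1 t2 u : (Fin 2 → ℝ) → (Fin 2 → ℝ),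
      ContDiff ℝ (⊤ : ℕ∞) t1 → HasCompactSupport t1 →
      ContDiff ℝ (⊤ : ℕ∞) t2 → HasCompactSupport t2 →
      ContDiff ℝ (⊤ : ℕ∞) u → HasCompactSupport u →
      |formM t1 t2 u| ≤
        C * (gradNorm t1) ^ (1/2 : ℝ) * (lapNorm t1) ^ (1/2 : ℝ)
          * (gradNorm t2) ^ (1/2 : ℝ) * (lapNorm t2) ^ (1/2 : ℝ) * gradNorm u := by
  obtain ⟨K, hK, hLad⟩ := exists_integral_pow_four_le
  refine ⟨8 * (K + 1), by positivity, fun t1 t2 u ht1 ht1c ht2 ht2c hu huc => ?_⟩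
  have hc : ∀ {g : (Fin 2 → ℝ) → (Fin 2 → ℝ)}, ContDiff ℝ (⊤ : ℕ∞) g → ∀ i k,
      ContDiff ℝ (⊤ : ℕ∞) (pderivE (fun y => g y k) i) := fun hg i k =>
    contDiff_pderivE (contDiff_pi.1 hg k) i
  have hs : ∀ {g : (Fin 2 → ℝ) → (Fin 2 → ℝ)}, HasCompactSupport g → ∀ i k,
      HasCompactSupport (pderivE (fun y => g y k) i) := fun hgc i k =>
    hasCompactSupport_pderivE (hgc.comp_left (g := fun v : Fin 2 → ℝ => v k) rfl) i
  have h4 : ∀ {g : (Fin 2 → ℝ) → (Fin 2 → ℝ)}, ContDiff ℝ (⊤ : ℕ∞) g → HasCompactSupport g →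
      ∀ i k, ∫ x, pderivE (fun y => g y k) i x ^ 4 ≤ K * (gradNorm g ^ 2 * lapNorm g ^ 2) :=
    fun hg hgc i k => (hLad _ (hc hg i k) (hs hgc i k)).trans <|
      mul_le_mul_of_nonneg_left
        (mul_le_mul (integral_pderivE_sq_le_gradNorm_sq hg hgc i k)
          (sum_integral_pderivE_pderivE_sq_le_lapNorm_sq hg hgc i k)
          (Finset.sum_nonneg fun _ _ => integral_nonneg fun _ => sq_nonneg _) (sq_nonneg _)) hK
  have hG1 := gradNorm_nonneg t1
  have hG2 := gradNorm_nonneg t2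
  have hGu := gradNorm_nonneg u
  have hL1 := lapNorm_nonneg t1
  have hL2 := lapNorm_nonneg t2
  have hrpow : ∀ {r : ℝ}, 0 ≤ r → (r ^ (1/2 : ℝ)) ^ 4 = r ^ 2 := fun {r} hr => by
    rw [← Real.sqrt_eq_rpow, show (4 : ℕ) = 2 * 2 from rfl, pow_mul, Real.sq_sqrt hr]
  set X : ℝ := (gradNorm t1) ^ (1/2 : ℝ) * (lapNorm t1) ^ (1/2 : ℝ) * (gradNorm t2) ^ (1/2 : ℝ) *
    (lapNorm t2) ^ (1/2 : ℝ) * gradNorm u with hX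
  have hX0 : 0 ≤ X := by positivity
  have hX4 : X ^ 4 = (gradNorm t1 ^ 2 * lapNorm t1 ^ 2) * (gradNorm t2 ^ 2 * lapNorm t2 ^ 2) *
      (gradNorm u ^ 2) ^ 2 := by
    rw [hX]
    simp only [mul_pow, hrpow hG1, hrpow hG2, hrpow hL1, hrpow hL2]
    ring
  have hKK : K * K ≤ (K + 1) ^ 4 := by
    nlinarith [pow_nonneg hK 2, pow_nonneg hK 3, pow_nonneg hK 4]
  have hterm : ∀ i j k : Fin 2, |∫ x : Fin 2 → ℝ, pderivE (fun y => t1 y k) i x *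
      pderivE (fun y => t2 y k) j x * pderivE (fun y => u y i) j x| ≤ (K + 1) * X := by
    intro i j k
    rw [← pow_le_pow_iff_left₀ (abs_nonneg _) (by positivity) four_ne_zero,
      (show Even 4 by decide).pow_abs]
    calc _ ≤ (∫ x, pderivE (fun y => t1 y k) i x ^ 4) * (∫ x, pderivE (fun y => t2 y k) j x ^ 4) *
          (∫ x, pderivE (fun y => u y i) j x ^ 2) ^ 2 :=
          integral_mul_mul_pow_four_le (hc ht1 i k).continuous (hs ht1c i k)
            (hc ht2 j k).continuous (hs ht2c j k) (hc hu j i).continuous (hs huc j i)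
      _ ≤ (K * (gradNorm t1 ^ 2 * lapNorm t1 ^ 2)) * (K * (gradNorm t2 ^ 2 * lapNorm t2 ^ 2)) *
          (gradNorm u ^ 2) ^ 2 := by
          gcongr
          · exact h4 ht1 ht1c i k
          · exact h4 ht2 ht2c j k
          · exact integral_pderivE_sq_le_gradNorm_sq hu huc j i
      _ = K * K * X ^ 4 := by rw [hX4]; ring
      _ ≤ (K + 1) ^ 4 * X ^ 4 := by gcongr
      _ = _ := by ring
  calc |formM t1 t2 u| ≤ ∑ _i : Fin 2, ∑ _j : Fin 2, ∑ _k : Fin 2, (K + 1) * X := by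
        rw [formM, abs_neg]
        refine (Finset.abs_sum_le_sum_abs _ _).trans (Finset.sum_le_sum fun i _ => ?_)
        refine (Finset.abs_sum_le_sum_abs _ _).trans (Finset.sum_le_sum fun j _ => ?_)
        exact (Finset.abs_sum_le_sum_abs _ _).trans (Finset.sum_le_sum fun k _ => hterm i j k)
    _ = _ := by
        simp only [Finset.sum_const, Finset.card_univ, Fintype.card_fin, nsmul_eq_mul, hX]
        push_cast
        ring

end
end
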